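/- arXiv:2010.12130 — 12 statements merged into one kernel-verified Lean document; each statement's English description precedes it below -/
import Mathlib

section
/- Let λ > 0 and let A = diag(1, λ) be a 2×2 real matrix. Let u, v, g_k ∈ ℝ² and let ψ₁, ψ₂, ψ₃, ψ₄ : ℝ → ℝ satisfy ψ₁(z)ψ₂(z) = ψ₃(z)ψ₄(z) for z = 1 and z = λ; write ψᵢ(A) = diag(ψᵢ(1), ψᵢ(λ)). Assume Δ := g_k⁽¹⁾g_k⁽²⁾·[u⁽¹⁾v⁽²⁾(ψ₁(1)ψ₂(λ) − ψ₃(1)ψ₄(λ)) + u⁽²⁾v⁽¹⁾(ψ₁(λ)ψ₂(1) − ψ₃(λ)ψ₄(1))] ≠ 0 and that α_k ∈ ℝ satisfies (uᵀψ₁(A)(I − α_k A)g_k)·(vᵀψ₂(A)(I − α_k A)g_k) = (uᵀψ₃(A)(I − α_k A)g_k)·(vᵀψ₄(A)(I − α_k A)g_k). Set g_{k+1} = (I − α_k A)g_k and, for an arbitrary α_{k+1} ∈ ℝ, g_{k+2} = (I − α_{k+1}A)g_{k+1}. Suppose further that whenever g_{k+1} ≠ 0 and g_{k+2} ≠ 0,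 the next stepsize satisfies α_{k+2} = ((Aᵘw)ᵀ(Aᵘw))/((Aᵘw)ᵀA(Aᵘw)) for some natural number μ and some w ∈ {g_{k+1}, g_{k+2}}, and set g_{k+3} = (I − α_{k+2}A)g_{k+2}. Then g_{k+1} = 0 or g_{k+2} = 0 or g_{k+3} = 0. -/
open Matrix

/-- The inverse Rayleigh quotient of a diagonal matrix at an eigenvector supported on a single
coordinate is the inverse of the corresponding diagonal entry. -/
lemma inv_rayleigh_diagonal_of_support {n : Type*} [Fintype n] [DecidableEq n]
    {d w : n → ℝ} {i : n} (hd : d i ≠ 0) (hwi : w i ≠ 0) (hw : ∀ j, j ≠ i → w j = 0) (μ : ℕ) :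
    ((diagonal d ^ μ *ᵥ w) ⬝ᵥ (diagonal d ^ μ *ᵥ w)) /
      ((diagonal d ^ μ *ᵥ w) ⬝ᵥ (diagonal d *ᵥ (diagonal d ^ μ *ᵥ w))) = (d i)⁻¹ := by
  simp only [diagonal_pow, dotProduct, mulVec_diagonal, Pi.pow_apply]
  rw [Finset.sum_eq_single i (by simp +contextual [hw]) (by simp),
    Finset.sum_eq_single i (by simp +contextual [hw]) (by simp)]
  field_simp

/-- A gradient step with the inverse Rayleigh quotient stepsize taken at a vector supported on
the coordinate `i` annihilates every vector supported on `i`. -/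
lemma gradient_step_eq_zero_of_support {n : Type*} [Fintype n] [DecidableEq n]
    {d w g : n → ℝ} {i : n} (hd : d i ≠ 0) (hw0 : w ≠ 0) (hw : ∀ j, j ≠ i → w j = 0)
    (hg : ∀ j, j ≠ i → g j = 0) (μ : ℕ) {α : ℝ}
    (hα : α = ((diagonal d ^ μ *ᵥ w) ⬝ᵥ (diagonal d ^ μ *ᵥ w)) /
      ((diagonal d ^ μ *ᵥ w) ⬝ᵥ (diagonal d *ᵥ (diagonal d ^ μ *ᵥ w)))) :
    (1 - α • diagonal d) *ᵥ g = 0 := by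
  have hwi : w i ≠ 0 := fun h ↦ hw0 <| funext fun j ↦ by
    by_cases hj : j = i
    · simp [hj, h]
    · exact hw j hj
  rw [inv_rayleigh_diagonal_of_support hd hwi hw μ] at hα
  ext j
  by_cases hj : j = i
  · subst hj
    simp [sub_mulVec, smul_mulVec, mulVec_diagonal, hα, hd]
  · simp [sub_mulVec, smul_mulVec, mulVec_diagonal, hg j hj]

/-- Theorem 2.1 (after reduction to `A = diag(1, λ)`): if the stepsize `αk` solves the
two-dimensional quadratic-termination equation and the later stepsize `αk2` has the
reciprocal Rayleigh quotient form, then one of the next three gradients vanishes. -/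
theorem stmt_0 (lam : ℝ) (hlam : 0 < lam)
    (A : Matrix (Fin 2) (Fin 2) ℝ) (hA : A = Matrix.diagonal ![1, lam])
    (u v gk : Fin 2 → ℝ) (ψ₁ ψ₂ ψ₃ ψ₄ : ℝ → ℝ)
    (hψ1 : ψ₁ 1 * ψ₂ 1 = ψ₃ 1 * ψ₄ 1)
    (hψlam : ψ₁ lam * ψ₂ lam = ψ₃ lam * ψ₄ lam)
    (hΔ : gk 0 * gk 1 *
        (u 0 * v 1 * (ψ₁ 1 * ψ₂ lam - ψ₃ 1 * ψ₄ lam) +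
         u 1 * v 0 * (ψ₁ lam * ψ₂ 1 - ψ₃ lam * ψ₄ 1)) ≠ 0)
    (αk αk1 αk2 : ℝ) (g1 g2 g3 : Fin 2 → ℝ)
    (heq :
      (u ⬝ᵥ (Matrix.diagonal ![ψ₁ 1, ψ₁ lam] *ᵥ ((1 - αk • A) *ᵥ gk))) *
        (v ⬝ᵥ (Matrix.diagonal ![ψ₂ 1, ψ₂ lam] *ᵥ ((1 - αk • A) *ᵥ gk))) =
      (u ⬝ᵥ (Matrix.diagonal ![ψ₃ 1, ψ₃ lam] *ᵥ ((1 - αk • A) *ᵥ gk))) *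
        (v ⬝ᵥ (Matrix.diagonal ![ψ₄ 1, ψ₄ lam] *ᵥ ((1 - αk • A) *ᵥ gk))))
    (hg1 : g1 = (1 - αk • A) *ᵥ gk)
    (hg2 : g2 = (1 - αk1 • A) *ᵥ g1)
    (hstep : g1 ≠ 0 → g2 ≠ 0 → ∃ (μ : ℕ) (w : Fin 2 → ℝ), (w = g1 ∨ w = g2) ∧
      αk2 = ((A ^ μ *ᵥ w) ⬝ᵥ (A ^ μ *ᵥ w)) / ((A ^ μ *ᵥ w) ⬝ᵥ (A *ᵥ (A ^ μ *ᵥ w))))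
    (hg3 : g3 = (1 - αk2 • A) *ᵥ g2) :
    g1 = 0 ∨ g2 = 0 ∨ g3 = 0 := by
  subst hA
  have step (α : ℝ) (x : Fin 2 → ℝ) (i : Fin 2) :
      ((1 - α • diagonal ![1, lam]) *ᵥ x) i = (1 - α * ![1, lam] i) * x i := by
    simp only [sub_mulVec, one_mulVec, smul_mulVec, Pi.sub_apply, Pi.smul_apply,
      mulVec_diagonal, smul_eq_mul]
    ring
  have hcoord : ∃ i, ∀ j, j ≠ i → g1 j = 0 := by
    have hprod : (1 - αk) * (1 - αk * lam) = 0 := by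
      refine (mul_eq_zero.mp ?_).resolve_right hΔ
      simp only [dotProduct, mulVec_diagonal, Fin.sum_univ_two, step, cons_val_zero,
        cons_val_one] at heq
      linear_combination heq - u 0 * v 0 * ((1 - αk) * gk 0) ^ 2 * hψ1
        - u 1 * v 1 * ((1 - αk * lam) * gk 1) ^ 2 * hψlam
    rcases mul_eq_zero.mp hprod with h | h
    · refine ⟨1, fun j hj ↦ ?_⟩
      fin_cases j <;> simp_all
    · refine ⟨0, fun j hj ↦ ?_⟩
      fin_cases j <;> simp_all
  obtain ⟨i, h1⟩ := hcoord
  have h2 : ∀ j, j ≠ i → g2 j = 0 := fun j hj ↦ by rw [hg2, step, h1 j hj, mul_zero]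
  have hd : (![1, lam] : Fin 2 → ℝ) i ≠ 0 := by
    fin_cases i <;> simp [hlam.ne']
  by_contra! ⟨hg1ne, hg2ne, hg3ne⟩
  obtain ⟨μ, w, rfl | rfl, hα⟩ := hstep hg1ne hg2ne
  · exact hg3ne (hg3.trans (gradient_step_eq_zero_of_support hd hg1ne h1 h2 μ hα))
  · exact hg3ne (hg3.trans (gradient_step_eq_zero_of_support hd hg2ne h2 h2 μ hα))
end

section
/- Let λ > 0 and let A = diag(1, λ) be a 2×2 real matrix. Let u, v, g_k ∈ ℝ² and let ψ₁, ψ₂, ψ₃, ψ₄ : ℝ → ℝ satisfy ψ₁(z)ψ₂(z) = ψ₃(z)ψ₄(z) for z = 1 and z = λ; write ψᵢ(A) = diag(ψᵢ(1), ψᵢ(λ)). Define φ₁ = (uᵀψ₁(A)Ag_k)(vᵀψ₂(A)Ag_k) − (uᵀψ₃(A)Ag_k)(vᵀψ₄(A)Ag_k), φ₂ = (uᵀψ₁(A)g_k)(vᵀψ₂(A)Ag_k) + (uᵀψ₁(A)Ag_k)(vᵀψ₂(A)g_k) − (uᵀψ₃(A)g_k)(vᵀψ₄(A)Ag_k) −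 (uᵀψ₃(A)Ag_k)(vᵀψ₄(A)g_k), and φ₃ = (uᵀψ₁(A)g_k)(vᵀψ₂(A)g_k) − (uᵀψ₃(A)g_k)(vᵀψ₄(A)g_k). Then φ₁ = λΔ, φ₂ = (1+λ)Δ and φ₃ = Δ, where Δ = g_k⁽¹⁾g_k⁽²⁾·[u⁽¹⁾v⁽²⁾(ψ₁(1)ψ₂(λ) − ψ₃(1)ψ₄(λ)) + u⁽²⁾v⁽¹⁾(ψ₁(λ)ψ₂(1) − ψ₃(λ)ψ₄(1))]. -/
open Matrix

/-- Coefficient computation in the proof of Theorem 2.1: the coefficients of the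
quadratic equation `φ₁ α² − φ₂ α + φ₃ = 0` equal `λΔ`, `(1+λ)Δ` and `Δ`. -/
theorem stmt_1 (lam : ℝ) (hlam : 0 < lam)
    (A : Matrix (Fin 2) (Fin 2) ℝ) (hA : A = Matrix.diagonal ![1, lam])
    (u v gk : Fin 2 → ℝ) (ψ₁ ψ₂ ψ₃ ψ₄ : ℝ → ℝ)
    (hψ1 : ψ₁ 1 * ψ₂ 1 = ψ₃ 1 * ψ₄ 1)
    (hψlam : ψ₁ lam * ψ₂ lam = ψ₃ lam * ψ₄ lam)
    (Δ φ₁ φ₂ φ₃ : ℝ)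
    (hΔ : Δ = gk 0 * gk 1 *
        (u 0 * v 1 * (ψ₁ 1 * ψ₂ lam - ψ₃ 1 * ψ₄ lam) +
         u 1 * v 0 * (ψ₁ lam * ψ₂ 1 - ψ₃ lam * ψ₄ 1)))
    (hφ₁ : φ₁ =
      (u ⬝ᵥ (Matrix.diagonal ![ψ₁ 1, ψ₁ lam] *ᵥ (A *ᵥ gk))) *
        (v ⬝ᵥ (Matrix.diagonal ![ψ₂ 1, ψ₂ lam] *ᵥ (A *ᵥ gk))) -
      (u ⬝ᵥ (Matrix.diagonal ![ψ₃ 1, ψ₃ lam] *ᵥ (A *ᵥ gk))) *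
        (v ⬝ᵥ (Matrix.diagonal ![ψ₄ 1, ψ₄ lam] *ᵥ (A *ᵥ gk))))
    (hφ₂ : φ₂ =
      (u ⬝ᵥ (Matrix.diagonal ![ψ₁ 1, ψ₁ lam] *ᵥ gk)) *
        (v ⬝ᵥ (Matrix.diagonal ![ψ₂ 1, ψ₂ lam] *ᵥ (A *ᵥ gk))) +
      (u ⬝ᵥ (Matrix.diagonal ![ψ₁ 1, ψ₁ lam] *ᵥ (A *ᵥ gk))) *
        (v ⬝ᵥ (Matrix.diagonal ![ψ₂ 1, ψ₂ lam] *ᵥ gk)) -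
      (u ⬝ᵥ (Matrix.diagonal ![ψ₃ 1, ψ₃ lam] *ᵥ gk)) *
        (v ⬝ᵥ (Matrix.diagonal ![ψ₄ 1, ψ₄ lam] *ᵥ (A *ᵥ gk))) -
      (u ⬝ᵥ (Matrix.diagonal ![ψ₃ 1, ψ₃ lam] *ᵥ (A *ᵥ gk))) *
        (v ⬝ᵥ (Matrix.diagonal ![ψ₄ 1, ψ₄ lam] *ᵥ gk)))
    (hφ₃ : φ₃ =
      (u ⬝ᵥ (Matrix.diagonal ![ψ₁ 1, ψ₁ lam] *ᵥ gk)) *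
        (v ⬝ᵥ (Matrix.diagonal ![ψ₂ 1, ψ₂ lam] *ᵥ gk)) -
      (u ⬝ᵥ (Matrix.diagonal ![ψ₃ 1, ψ₃ lam] *ᵥ gk)) *
        (v ⬝ᵥ (Matrix.diagonal ![ψ₄ 1, ψ₄ lam] *ᵥ gk))) :
    φ₁ = lam * Δ ∧ φ₂ = (1 + lam) * Δ ∧ φ₃ = Δ := by
  subst hA hΔ hφ₁ hφ₂ hφ₃
  simp only [dotProduct, Fin.sum_univ_two, mulVec_diagonal, Matrix.cons_val_zero,
    Matrix.cons_val_one, one_mul]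
  refine ⟨?_, ?_, ?_⟩
  · linear_combination u 0 * v 0 * gk 0 ^ 2 * hψ1 + lam ^ 2 * (u 1 * v 1 * gk 1 ^ 2) * hψlam
  · linear_combination 2 * (u 0 * v 0 * gk 0 ^ 2) * hψ1 +
      2 * lam * (u 1 * v 1 * gk 1 ^ 2) * hψlam
  · linear_combination u 0 * v 0 * gk 0 ^ 2 * hψ1 + u 1 * v 1 * gk 1 ^ 2 * hψlam
end

section
/- Let λ > 0 and let A = diag(1, λ) be a 2×2 real matrix. Let u, v, g_k ∈ ℝ² and let ψ₁, ψ₂, ψ₃, ψ₄ : ℝ → ℝ satisfy ψ₁(z)ψ₂(z) = ψ₃(z)ψ₄(z) for z = 1 and z = λ; write ψᵢ(A) = diag(ψᵢ(1), ψᵢ(λ)). Assume Δ := g_k⁽¹⁾g_k⁽²⁾·[u⁽¹⁾v⁽²⁾(ψ₁(1)ψ₂(λ) − ψ₃(1)ψ₄(λ)) + u⁽²⁾v⁽¹⁾(ψ₁(λ)ψ₂(1) − ψ₃(λ)ψ₄(1))] ≠ 0. Then a real number α satisfies (uᵀψ₁(A)(I − αA)g_k)·(vᵀψ₂(A)(I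 − αA)g_k) = (uᵀψ₃(A)(I − αA)g_k)·(vᵀψ₄(A)(I − αA)g_k) if and only if α = 1 or α = 1/λ. -/
open Matrix

/-- Pairing a vector with `diag(a, b) (I - α diag(1, μ)) g`, in coordinates. -/
lemma dotProduct_diagonal_mulVec_one_sub_smul (μ α a b : ℝ) (w g : Fin 2 → ℝ) :
    w ⬝ᵥ (Matrix.diagonal ![a, b] *ᵥ ((1 - α • Matrix.diagonal ![1, μ]) *ᵥ g)) =
      w 0 * a * ((1 - α) * g 0) + w 1 * b * ((1 - α * μ) * g 1) := by
  simp [Matrix.mulVec, dotProduct, Fin.sum_univ_two]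
  ring

/-- The two roots of the quadratic-termination equation (2.9): when `Δ ≠ 0`,
a real `α` solves the equation iff `α = 1` or `α = 1/λ`. -/
theorem stmt_2 (lam : ℝ) (hlam : 0 < lam)
    (A : Matrix (Fin 2) (Fin 2) ℝ) (hA : A = Matrix.diagonal ![1, lam])
    (u v gk : Fin 2 → ℝ) (ψ₁ ψ₂ ψ₃ ψ₄ : ℝ → ℝ)
    (hψ1 : ψ₁ 1 * ψ₂ 1 = ψ₃ 1 * ψ₄ 1)
    (hψlam : ψ₁ lam * ψ₂ lam = ψ₃ lam * ψ₄ lam)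
    (hΔ : gk 0 * gk 1 *
        (u 0 * v 1 * (ψ₁ 1 * ψ₂ lam - ψ₃ 1 * ψ₄ lam) +
         u 1 * v 0 * (ψ₁ lam * ψ₂ 1 - ψ₃ lam * ψ₄ 1)) ≠ 0)
    (α : ℝ) :
    ((u ⬝ᵥ (Matrix.diagonal ![ψ₁ 1, ψ₁ lam] *ᵥ ((1 - α • A) *ᵥ gk))) *
        (v ⬝ᵥ (Matrix.diagonal ![ψ₂ 1, ψ₂ lam] *ᵥ ((1 - α • A) *ᵥ gk))) =
      (u ⬝ᵥ (Matrix.diagonal ![ψ₃ 1, ψ₃ lam] *ᵥ ((1 - α • A) *ᵥ gk))) *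
        (v ⬝ᵥ (Matrix.diagonal ![ψ₄ 1, ψ₄ lam] *ᵥ ((1 - α • A) *ᵥ gk))))
    ↔ (α = 1 ∨ α = 1 / lam) := by
  subst hA
  simp only [dotProduct_diagonal_mulVec_one_sub_smul]
  have hroot : α = 1 / lam ↔ 1 - α * lam = 0 := by
    rw [eq_div_iff hlam.ne', sub_eq_zero, eq_comm]
  have hone : α = 1 ↔ 1 - α = 0 := by rw [sub_eq_zero, eq_comm]
  rw [hroot, hone, ← mul_eq_zero, ← mul_eq_zero_iff_right hΔ, ← sub_eq_zero]
  refine Eq.congr ?_ rfl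
  linear_combination u 0 * v 0 * ((1 - α) * gk 0) ^ 2 * hψ1 +
    u 1 * v 1 * ((1 - α * lam) * gk 1) ^ 2 * hψlam
end

section
/- Let A be an n×n real symmetric positive definite matrix. Let g_{k−1} ∈ ℝⁿ be nonzero, let α_{k−1} = α_{k−1}^{SD} := (g_{k−1}ᵀg_{k−1})/(g_{k−1}ᵀAg_{k−1}), suppose I − α_{k−1}A is invertible, and let g_k = (I − α_{k−1}A)g_{k−1} be nonzero. Define α_k^{SD} = (g_kᵀg_k)/(g_kᵀAg_k) and the Dai–Yuan stepsize α_k^{DY} = 2 / ( 1/α_{k−1}^{SD} + 1/α_k^{SD} + √( (1/α_{k−1}^{SD} − 1/α_k^{SD})² + 4‖g_k‖²/(α_{k−1}^{SD}‖g_{k−1}‖)² ) ), where ‖·‖ is the Euclidean norm. Then α = α_k^{DY} satisfies (g_{k−1}ᵀ(I − α_{k−1}A)^{-1}(I − αA)g_k)·(g_kᵀ(I − αA)g_k) = (g_{k−1}ᵀ(I − αA)g_k)·(g_kᵀ(I − α_{k−1}A)^{-1}(I − αA)g_k). -/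
open Matrix

/-- If `b = 2 / (u + v + √((u - v) ^ 2 + 4 * w))`, then `1 / b` is a root of
`(t - u) * (t - v) = w`. -/
theorem one_sub_mul_one_sub_of_eq_two_div {u v w b : ℝ} (hu : 0 < u) (hv : 0 < v) (hw : 0 ≤ w)
    (hb : b = 2 / (u + v + Real.sqrt ((u - v) ^ 2 + 4 * w))) :
    (1 - b * u) * (1 - b * v) = b ^ 2 * w := by
  have hS := Real.sq_sqrt (show 0 ≤ (u - v) ^ 2 + 4 * w by positivity)
  have hS0 := Real.sqrt_nonneg ((u - v) ^ 2 + 4 * w)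
  set S := Real.sqrt ((u - v) ^ 2 + 4 * w)
  have hD : u + v + S ≠ 0 := by positivity
  have hbD : b * (u + v + S) = 2 := by rw [hb, div_mul_cancel₀ _ hD]
  linear_combination (b ^ 2 / 4) * hS + (-(1 / 2) + b * (u + v - S) / 4) * hbD

/-- Theorem 2.2: the Dai–Yuan stepsize solves the quadratic-termination equation (2.9)
with `ν₁(k) = k−1`, `ν₂(k) = k`, `ψ₁(A) = ψ₄(A) = (I − α_{k−1}A)⁻¹`, `ψ₂(A) = ψ₃(A) = I`,
when the previous step is an exact steepest-descent step. -/
theorem stmt_4 {n : ℕ} (A : Matrix (Fin n) (Fin n) ℝ) (hA : A.PosDef)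
    (gkm1 : Fin n → ℝ) (hgkm1 : gkm1 ≠ 0)
    (αkm1 : ℝ) (hαkm1 : αkm1 = (gkm1 ⬝ᵥ gkm1) / (gkm1 ⬝ᵥ (A *ᵥ gkm1)))
    (hinv : IsUnit (1 - αkm1 • A))
    (gk : Fin n → ℝ) (hgk : gk = (1 - αkm1 • A) *ᵥ gkm1) (hgk0 : gk ≠ 0)
    (αkSD αDY : ℝ)
    (hαkSD : αkSD = (gk ⬝ᵥ gk) / (gk ⬝ᵥ (A *ᵥ gk)))
    (hDY : αDY = 2 / (1 / αkm1 + 1 / αkSD +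
      Real.sqrt ((1 / αkm1 - 1 / αkSD) ^ 2 +
        4 * (gk ⬝ᵥ gk) / (αkm1 ^ 2 * (gkm1 ⬝ᵥ gkm1))))) :
    (gkm1 ⬝ᵥ ((1 - αkm1 • A)⁻¹ *ᵥ ((1 - αDY • A) *ᵥ gk))) *
      (gk ⬝ᵥ ((1 - αDY • A) *ᵥ gk)) =
    (gkm1 ⬝ᵥ ((1 - αDY • A) *ᵥ gk)) *
      (gk ⬝ᵥ ((1 - αkm1 • A)⁻¹ *ᵥ ((1 - αDY • A) *ᵥ gk))) := by
  have hmul (b : ℝ) (x : Fin n → ℝ) : (1 - b • A) *ᵥ x = x - b • (A *ᵥ x) := by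
    rw [sub_mulVec, one_mulVec, smul_mulVec]
  have hsymm (x y : Fin n → ℝ) : x ⬝ᵥ (A *ᵥ y) = y ⬝ᵥ (A *ᵥ x) := by
    have hT : Aᵀ = A := by simpa using hA.isHermitian.eq
    rw [dotProduct_mulVec, ← mulVec_transpose, hT, dotProduct_comm]
  have hpos {x : Fin n → ℝ} (hx : x ≠ 0) : 0 < x ⬝ᵥ (A *ᵥ x) := by
    simpa using hA.dotProduct_mulVec_pos hx
  have hself {x : Fin n → ℝ} (hx : x ≠ 0) : 0 < x ⬝ᵥ x := by
    simpa using dotProduct_star_self_pos_iff.2 hx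
  have hcomm : (1 - αkm1 • A)⁻¹ *ᵥ ((1 - αDY • A) *ᵥ gk) = (1 - αDY • A) *ᵥ gkm1 := by
    have hc : Commute (1 - αDY • A) (1 - αkm1 • A) :=
      ((Commute.one_left _).sub_left
        (((Commute.one_right A).sub_right ((Commute.refl A).smul_right _)).smul_left _))
    rw [hgk, mulVec_mulVec gkm1 (1 - αDY • A), hc.eq, mulVec_mulVec, ← mul_assoc,
      nonsing_inv_mul _ ((isUnit_iff_isUnit_det _).1 hinv), one_mul]
  have hp := hself hgkm1
  have hq := hpos hgkm1
  have hr := hself hgk0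
  have hs := hpos hgk0
  have hα : 0 < αkm1 := hαkm1 ▸ div_pos hp hq
  have hαk : 0 < αkSD := hαkSD ▸ div_pos hr hs
  have hαq : αkm1 * (gkm1 ⬝ᵥ (A *ᵥ gkm1)) = gkm1 ⬝ᵥ gkm1 := by
    rw [hαkm1, div_mul_cancel₀ _ hq.ne']
  have hαs : αkSD * (gk ⬝ᵥ (A *ᵥ gk)) = gk ⬝ᵥ gk := by
    rw [hαkSD, div_mul_cancel₀ _ hs.ne']
  have horth : gkm1 ⬝ᵥ gk = 0 := by
    rw [hgk, hmul, dotProduct_sub, dotProduct_smul, smul_eq_mul, hαq, sub_self]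
  have hcross : αkm1 * (gk ⬝ᵥ (A *ᵥ gkm1)) = -(gk ⬝ᵥ gk) := by
    have h : gk ⬝ᵥ gk = gk ⬝ᵥ (gkm1 - αkm1 • (A *ᵥ gkm1)) := by rw [← hmul, ← hgk]
    rw [dotProduct_sub, dotProduct_smul, smul_eq_mul, dotProduct_comm gk gkm1, horth] at h
    linarith
  have hroot := one_sub_mul_one_sub_of_eq_two_div (w := (gk ⬝ᵥ gk) / (αkm1 ^ 2 * (gkm1 ⬝ᵥ gkm1)))
    (b := αDY)
    (one_div_pos.2 hα) (one_div_pos.2 hαk) (by positivity) (by rw [← mul_div_assoc]; exact hDY)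
  rw [hcomm]
  simp only [hmul, dotProduct_sub, dotProduct_smul, smul_eq_mul, horth, dotProduct_comm gk gkm1,
    hsymm gkm1 gk]
  have hq' : gkm1 ⬝ᵥ (A *ᵥ gkm1) = (gkm1 ⬝ᵥ gkm1) * (1 / αkm1) := by
    rw [← hαq]; field_simp
  have hs' : gk ⬝ᵥ (A *ᵥ gk) = (gk ⬝ᵥ gk) * (1 / αkSD) := by
    rw [← hαs]; field_simp
  have hc' : gk ⬝ᵥ (A *ᵥ gkm1) = -((gk ⬝ᵥ gk) / αkm1) := by
    rw [← neg_div, ← hcross]; field_simp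
  have hw : (gkm1 ⬝ᵥ gkm1) * (gk ⬝ᵥ gk) * ((gk ⬝ᵥ gk) / (αkm1 ^ 2 * (gkm1 ⬝ᵥ gkm1))) =
      ((gk ⬝ᵥ gk) / αkm1) ^ 2 := by
    field_simp
  rw [hq', hs', hc']
  linear_combination (gkm1 ⬝ᵥ gkm1) * (gk ⬝ᵥ gk) * hroot + αDY ^ 2 * hw
end

section
/- Let A be an n×n real symmetric positive definite matrix. Let g_{k−2} ∈ ℝⁿ be nonzero, let α_{k−2}, α_{k−1} ∈ ℝ be nonzero with I − α_{k−2}A and I − α_{k−1}A invertible, let g_{k−1} = (I − α_{k−2}A)g_{k−2} be nonzero, and let g_k = (I − α_{k−1}A)g_{k−1}. Define the Barzilai–Borwein stepsizes α_{k−1}^{BB1} = (g_{k−2}ᵀg_{k−2})/(g_{k−2}ᵀAg_{k−2}), α_{k−1}^{BB2} = (g_{k−2}ᵀAg_{k−2})/(g_{k−2}ᵀA²g_{k−2}), α_k^{BB1} = (g_{k−1}ᵀg_{k−1})/(g_{k−1}ᵀAg_{k−1}), α_k^{BB2} = (g_{k−1}ᵀAg_{k−1})/(g_{k−1}ᵀA²g_{k−1}),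 and assume α_{k−1}^{BB1} ≠ α_k^{BB1}. Set r₁ = (α_{k−1}^{BB2} − α_k^{BB2}) / (α_{k−1}^{BB2}·α_k^{BB2}·(α_{k−1}^{BB1} − α_k^{BB1})) and r₂ = (α_{k−1}^{BB1}α_{k−1}^{BB2} − α_k^{BB1}α_k^{BB2}) / (α_{k−1}^{BB2}·α_k^{BB2}·(α_{k−1}^{BB1} − α_k^{BB1})). Then r₂² − 4r₁ ≥ 0, and the new stepsize α_k^{new} = 2/(r₂ + √(r₂² − 4r₁)) satisfies (g_{k−2}ᵀ(I−α_{k−2}A)^{-1}(I−α_k^{new}A)g_k)·(g_{k−1}ᵀ(I−α_{k−1}A)^{-1}(I−α_k^{new}A)g_k) = (g_{k−2}ᵀ(I−α_{k−2}A)^{-1}(I−α_{k−1}A)^{-1}(I−α_k^{new}A)g_k)·(g_{k−1}ᵀ(I−α_k^{new}A)g_k). -/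
open Matrix

theorem Matrix.inv_mulVec_mulVec_mulVec_of_commute {n R : Type*} [Fintype n] [DecidableEq n]
    [CommRing R] {B C : Matrix n n R} (hB : IsUnit B) (h : Commute B C) (v : n → R) :
    B⁻¹ *ᵥ (C *ᵥ (B *ᵥ v)) = C *ᵥ v := by
  rw [mulVec_mulVec v C B, ← h.eq, mulVec_mulVec, ← mul_assoc,
    nonsing_inv_mul _ ((isUnit_iff_isUnit_det B).mp hB), one_mul]

theorem commute_one_sub_smul {R S : Type*} [CommRing R] [Ring S] [Algebra R S] (x y : R) (a : S) :
    Commute (1 - x • a) (1 - y • a) :=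
  (Commute.one_left _).sub_left
    ((Commute.one_right _).sub_right (((Commute.refl a).smul_left x).smul_right y))

theorem Matrix.dotProduct_one_sub_smul_mulVec {n R : Type*} [Fintype n] [DecidableEq n]
    [CommRing R] (A : Matrix n n R) (x : R) (u v : n → R) :
    u ⬝ᵥ ((1 - x • A) *ᵥ v) = u ⬝ᵥ v - x * (u ⬝ᵥ (A *ᵥ v)) := by
  simp [sub_mulVec, smul_mulVec, dotProduct_sub]

theorem Matrix.dotProduct_one_sub_smul_mulVec_one_sub_smul_mulVec {n R : Type*} [Fintype n]
    [DecidableEq n] [CommRing R] (A : Matrix n n R) (x y : R) (u v : n → R) :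
    u ⬝ᵥ ((1 - x • A) *ᵥ ((1 - y • A) *ᵥ v)) =
      u ⬝ᵥ v - (x + y) * (u ⬝ᵥ (A *ᵥ v)) + x * y * (u ⬝ᵥ (A ^ 2 *ᵥ v)) := by
  rw [dotProduct_one_sub_smul_mulVec, dotProduct_one_sub_smul_mulVec, pow_two, ← mulVec_mulVec]
  simp only [sub_mulVec, smul_mulVec, one_mulVec, mulVec_sub, mulVec_smul, dotProduct_sub,
    dotProduct_smul, smul_eq_mul]
  ring

/-- The Rayleigh moments of a positive definite matrix are positive and satisfy the
Cauchy–Schwarz inequality. -/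
theorem Matrix.PosDef.moments {n : Type*} [Fintype n] [DecidableEq n] {A : Matrix n n ℝ}
    (hA : A.PosDef) {v : n → ℝ} (hv : v ≠ 0) :
    0 < v ⬝ᵥ (A *ᵥ v) ∧ 0 < v ⬝ᵥ (A ^ 2 *ᵥ v) ∧
      (v ⬝ᵥ (A *ᵥ v)) ^ 2 ≤ (v ⬝ᵥ v) * (v ⬝ᵥ (A ^ 2 *ᵥ v)) := by
  have hsq : v ⬝ᵥ (A ^ 2 *ᵥ v) = (A *ᵥ v) ⬝ᵥ (A *ᵥ v) := by
    have hT : Aᵀ = A := by simpa using hA.isHermitian.eq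
    rw [pow_two, ← mulVec_mulVec, dotProduct_mulVec, ← mulVec_transpose, hT]
  have hpos : 0 < v ⬝ᵥ (A *ᵥ v) := by simpa using hA.dotProduct_mulVec_pos hv
  have hcs : (v ⬝ᵥ (A *ᵥ v)) ^ 2 ≤ (v ⬝ᵥ v) * (v ⬝ᵥ (A ^ 2 *ᵥ v)) := by
    rw [hsq]
    simpa [dotProduct, pow_two] using Finset.sum_mul_sq_le_sq_mul_sq Finset.univ v (A *ᵥ v)
  have hv0 : 0 ≤ v ⬝ᵥ v := by simpa using dotProduct_star_self_nonneg v
  exact ⟨hpos, pos_of_mul_pos_right ((pow_pos hpos 2).trans_le hcs) hv0, hcs⟩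

theorem discrim_nonneg_of_le {a b c d : ℝ} (hd : 0 < d) (hb : 0 < b) (hba : b ≤ a) :
    0 ≤ (a * b - c * d) ^ 2 - 4 * ((b - d) * (b * d * (a - c))) := by
  rcases le_total 0 ((a - c) * (b - d)) with h | h
  · have h' : 0 ≤ d * ((a - c) * (b - d)) * (a - b) :=
      mul_nonneg (mul_nonneg hd.le h) (sub_nonneg.mpr hba)
    nlinarith [sq_nonneg (2 * ((a - c) * d) - (a * b - c * d))]
  · nlinarith [sq_nonneg (a * b - c * d), mul_nonneg (mul_pos hb hd).le (neg_nonneg.mpr h)]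

/-- The reciprocal of a nonzero root of `s ^ 2 - r₂ * s + r₁` given by the quadratic formula. -/
theorem reciprocal_root_eq_zero {r₁ r₂ : ℝ} (hD : 0 ≤ r₂ ^ 2 - 4 * r₁)
    (h0 : r₂ + √(r₂ ^ 2 - 4 * r₁) ≠ 0) :
    r₁ * (2 / (r₂ + √(r₂ ^ 2 - 4 * r₁))) ^ 2 - r₂ * (2 / (r₂ + √(r₂ ^ 2 - 4 * r₁))) + 1 = 0 := by
  have hs := Real.sq_sqrt hD
  generalize √(r₂ ^ 2 - 4 * r₁) = s at *
  field_simp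
  linear_combination hs

/-- Theorem 2.3: the new stepsize `α_k^{new} = 2/(r₂ + √(r₂² − 4r₁))`, built from the
Barzilai–Borwein stepsizes of two consecutive iterations, is well defined and solves
the quadratic-termination equation (2.12). -/
theorem stmt_7 {n : ℕ} (A : Matrix (Fin n) (Fin n) ℝ) (hA : A.PosDef)
    (gkm2 : Fin n → ℝ) (hgkm2 : gkm2 ≠ 0)
    (αkm2 αkm1 : ℝ) (hαkm2 : αkm2 ≠ 0) (hαkm1 : αkm1 ≠ 0)
    (hinv2 : IsUnit (1 - αkm2 • A)) (hinv1 : IsUnit (1 - αkm1 • A))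
    (gkm1 : Fin n → ℝ) (hgkm1 : gkm1 = (1 - αkm2 • A) *ᵥ gkm2) (hgkm10 : gkm1 ≠ 0)
    (gk : Fin n → ℝ) (hgk : gk = (1 - αkm1 • A) *ᵥ gkm1)
    (a1 b1 a2 b2 : ℝ)
    (ha1 : a1 = (gkm2 ⬝ᵥ gkm2) / (gkm2 ⬝ᵥ (A *ᵥ gkm2)))
    (hb1 : b1 = (gkm2 ⬝ᵥ (A *ᵥ gkm2)) / (gkm2 ⬝ᵥ (A ^ 2 *ᵥ gkm2)))
    (ha2 : a2 = (gkm1 ⬝ᵥ gkm1) / (gkm1 ⬝ᵥ (A *ᵥ gkm1)))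
    (hb2 : b2 = (gkm1 ⬝ᵥ (A *ᵥ gkm1)) / (gkm1 ⬝ᵥ (A ^ 2 *ᵥ gkm1)))
    (hne : a1 ≠ a2)
    (r1 r2 : ℝ)
    (hr1 : r1 = (b1 - b2) / (b1 * b2 * (a1 - a2)))
    (hr2 : r2 = (a1 * b1 - a2 * b2) / (b1 * b2 * (a1 - a2)))
    (αnew : ℝ) (hαnew : αnew = 2 / (r2 + Real.sqrt (r2 ^ 2 - 4 * r1))) :
    0 ≤ r2 ^ 2 - 4 * r1 ∧
    (gkm2 ⬝ᵥ ((1 - αkm2 • A)⁻¹ *ᵥ ((1 - αnew • A) *ᵥ gk))) *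
      (gkm1 ⬝ᵥ ((1 - αkm1 • A)⁻¹ *ᵥ ((1 - αnew • A) *ᵥ gk))) =
    (gkm2 ⬝ᵥ ((1 - αkm2 • A)⁻¹ *ᵥ ((1 - αkm1 • A)⁻¹ *ᵥ ((1 - αnew • A) *ᵥ gk)))) *
      (gkm1 ⬝ᵥ ((1 - αnew • A) *ᵥ gk)) := by
  obtain ⟨hc1, hc2, hcs⟩ := hA.moments hgkm2
  obtain ⟨hd1, hd2, -⟩ := hA.moments hgkm10
  have hb1pos : 0 < b1 := hb1 ▸ div_pos hc1 hc2
  have hb2pos : 0 < b2 := hb2 ▸ div_pos hd1 hd2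
  have hba : b1 ≤ a1 := by
    rw [ha1, hb1, div_le_div_iff₀ hc2 hc1]
    linarith
  have hsub : a1 - a2 ≠ 0 := sub_ne_zero.mpr hne
  have hD : 0 ≤ r2 ^ 2 - 4 * r1 := by
    have h : r2 ^ 2 - 4 * r1 = ((a1 * b1 - a2 * b2) ^ 2 -
        4 * ((b1 - b2) * (b1 * b2 * (a1 - a2)))) / (b1 * b2 * (a1 - a2)) ^ 2 := by
      rw [hr1, hr2]
      field_simp
    rw [h]
    exact div_nonneg (discrim_nonneg_of_le hb2pos hb1pos hba) (sq_nonneg _)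
  have hden : r2 + √(r2 ^ 2 - 4 * r1) ≠ 0 := by
    intro h
    have hr1z : r1 = 0 := by
      have hs := Real.sq_sqrt hD
      rw [eq_neg_of_add_eq_zero_right h] at hs
      linarith
    have hbb : b1 = b2 := by
      have hne0 : b1 * b2 * (a1 - a2) ≠ 0 := by positivity
      rw [hr1, div_eq_zero_iff] at hr1z
      exact sub_eq_zero.mp (hr1z.resolve_right hne0)
    have hr2pos : 0 < r2 := by
      have h2 : r2 = 1 / b2 := by
        rw [hr2, hbb]
        field_simp
      rw [h2]
      positivity
    linarith [Real.sqrt_nonneg (r2 ^ 2 - 4 * r1)]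
  refine ⟨hD, ?_⟩
  have hroot : r1 * αnew ^ 2 - r2 * αnew + 1 = 0 := hαnew ▸ reciprocal_root_eq_zero hD hden
  have e1 : (1 - αkm2 • A)⁻¹ *ᵥ ((1 - αnew • A) *ᵥ gk) =
      (1 - αnew • A) *ᵥ ((1 - αkm1 • A) *ᵥ gkm2) := by
    rw [hgk, hgkm1, mulVec_mulVec _ (1 - αkm1 • A), (commute_one_sub_smul αkm1 αkm2 A).eq,
      ← mulVec_mulVec,
      inv_mulVec_mulVec_mulVec_of_commute hinv2 (commute_one_sub_smul αkm2 αnew A)]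
  have e2 : (1 - αkm1 • A)⁻¹ *ᵥ ((1 - αnew • A) *ᵥ gk) = (1 - αnew • A) *ᵥ gkm1 := by
    rw [hgk, inv_mulVec_mulVec_mulVec_of_commute hinv1 (commute_one_sub_smul αkm1 αnew A)]
  have e3 : (1 - αkm2 • A)⁻¹ *ᵥ ((1 - αkm1 • A)⁻¹ *ᵥ ((1 - αnew • A) *ᵥ gk)) =
      (1 - αnew • A) *ᵥ gkm2 := by
    rw [e2, hgkm1, inv_mulVec_mulVec_mulVec_of_commute hinv2 (commute_one_sub_smul αkm2 αnew A)]
  rw [e3, e1, e2, hgk]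
  simp only [dotProduct_one_sub_smul_mulVec_one_sub_smul_mulVec]
  simp only [dotProduct_one_sub_smul_mulVec]
  generalize gkm2 ⬝ᵥ gkm2 = c0 at *
  generalize gkm2 ⬝ᵥ (A *ᵥ gkm2) = c1 at *
  generalize gkm2 ⬝ᵥ (A ^ 2 *ᵥ gkm2) = c2 at *
  generalize gkm1 ⬝ᵥ gkm1 = d0 at *
  generalize gkm1 ⬝ᵥ (A *ᵥ gkm1) = d1 at *
  generalize gkm1 ⬝ᵥ (A ^ 2 *ᵥ gkm1) = d2 at *
  have hquad : (b1 - b2) * αnew ^ 2 - (a1 * b1 - a2 * b2) * αnew + b1 * b2 * (a1 - a2) = 0 := by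
    rw [hr1, hr2] at hroot
    field_simp at hroot
    linear_combination hroot
  have hmom : (c1 * d2 - c2 * d1) * αnew ^ 2 - (c0 * d2 - c2 * d0) * αnew +
      (c0 * d1 - c1 * d0) = 0 := by
    rw [ha1, ha2, hb1, hb2] at hquad
    field_simp at hquad
    linear_combination hquad
  linear_combination αkm1 * hmom
end

section
/- Let A be an n×n real symmetric matrix, let g_{k−2} ∈ ℝⁿ, let α_{k−2}, α_{k−1} ∈ ℝ with I − α_{k−2}A invertible, and let g_{k−1} = (I − α_{k−2}A)g_{k−2} and g_k = (I − α_{k−1}A)g_{k−1}. Assume g_{k−2}ᵀAg_{k−2} ≠ 0 and g_{k−2}ᵀA²g_{k−2} ≠ 0, and set α_{k−1}^{BB1} = (g_{k−2}ᵀg_{k−2})/(g_{k−2}ᵀAg_{k−2}) and α_{k−1}^{BB2} = (g_{k−2}ᵀAg_{k−2})/(g_{k−2}ᵀA²g_{k−2}). Then for every α ∈ ℝ: g_{k−2}ᵀ(I − α_{k−2}A)^{-1}(I − αA)g_k = (g_{k−2}ᵀAg_{k−2})·(α_{k−1}^{BB1} − α_{k−1}) − α·(g_{k−2}ᵀA²g_{k−2})·(α_{k−1}^{BB2}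 − α_{k−1}). -/
open Matrix

/-- First inner-product identity in the proof of Theorem 2.3:
`g_{k−2}ᵀ(I−α_{k−2}A)⁻¹(I−αA)g_k
  = (g_{k−2}ᵀAg_{k−2})(α_{k−1}^{BB1} − α_{k−1}) − α(g_{k−2}ᵀA²g_{k−2})(α_{k−1}^{BB2} − α_{k−1})`. -/
theorem stmt_8 {n : ℕ} (A : Matrix (Fin n) (Fin n) ℝ) (hA : A.IsSymm)
    (gkm2 : Fin n → ℝ) (αkm2 αkm1 : ℝ) (hinv : IsUnit (1 - αkm2 • A))
    (gkm1 gk : Fin n → ℝ)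
    (hgkm1 : gkm1 = (1 - αkm2 • A) *ᵥ gkm2)
    (hgk : gk = (1 - αkm1 • A) *ᵥ gkm1)
    (h1 : gkm2 ⬝ᵥ (A *ᵥ gkm2) ≠ 0) (h2 : gkm2 ⬝ᵥ (A ^ 2 *ᵥ gkm2) ≠ 0)
    (a1 b1 : ℝ)
    (ha1 : a1 = (gkm2 ⬝ᵥ gkm2) / (gkm2 ⬝ᵥ (A *ᵥ gkm2)))
    (hb1 : b1 = (gkm2 ⬝ᵥ (A *ᵥ gkm2)) / (gkm2 ⬝ᵥ (A ^ 2 *ᵥ gkm2)))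
    (α : ℝ) :
    gkm2 ⬝ᵥ ((1 - αkm2 • A)⁻¹ *ᵥ ((1 - α • A) *ᵥ gk)) =
      (gkm2 ⬝ᵥ (A *ᵥ gkm2)) * (a1 - αkm1) -
        α * (gkm2 ⬝ᵥ (A ^ 2 *ᵥ gkm2)) * (b1 - αkm1) := by
  have hcomm : (1 - α • A) * ((1 - αkm1 • A) * (1 - αkm2 • A)) =
      (1 - αkm2 • A) * (1 - (α + αkm1) • A + (α * αkm1) • A ^ 2) := by
    simp only [sub_mul, mul_sub, mul_add, add_smul, smul_mul_assoc, mul_smul_comm, smul_smul,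
      one_mul, mul_one, pow_two, mul_assoc, smul_sub]
    module
  have hdet : IsUnit (1 - αkm2 • A).det := (Matrix.isUnit_iff_isUnit_det _).mp hinv
  subst hgk hgkm1 ha1 hb1
  rw [mulVec_mulVec, mulVec_mulVec, mulVec_mulVec, mul_assoc, mul_assoc, hcomm,
    nonsing_inv_mul_cancel_left _ _ hdet]
  simp only [add_mulVec, sub_mulVec, smul_mulVec, one_mulVec, dotProduct_add, dotProduct_sub,
    dotProduct_smul, smul_eq_mul]
  field_simp
  ring
end

section
/- Let A be an n×n real symmetric matrix, let g_{k−2} ∈ ℝⁿ, let α_{k−2}, α_{k−1} ∈ ℝ with I − α_{k−2}A and I − α_{k−1}A invertible, and let g_{k−1} = (I − α_{k−2}A)g_{k−2} and g_k = (I − α_{k−1}A)g_{k−1}. Write ζ_{j,i} = g_jᵀAⁱg_j and assume ζ_{k−2,1}, ζ_{k−2,2}, ζ_{k−1,1}, ζ_{k−1,2} are nonzero; set α_{k−1}^{BB1} = ζ_{k−2,0}/ζ_{k−2,1}, α_{k−1}^{BB2} = ζ_{k−2,1}/ζ_{k−2,2}, α_k^{BB1} = ζ_{k−1,0}/ζ_{k−1,1},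 α_k^{BB2} = ζ_{k−1,1}/ζ_{k−1,2}. Write u = g_{k−2}, v = g_{k−1}, ψ₁(A) = (I−α_{k−2}A)^{-1}, ψ₂(A) = (I−α_{k−1}A)^{-1}, ψ₃(A) = (I−α_{k−2}A)^{-1}(I−α_{k−1}A)^{-1}, ψ₄(A) = I, and define φ₁ = (uᵀψ₁(A)Ag_k)(vᵀψ₂(A)Ag_k) − (uᵀψ₃(A)Ag_k)(vᵀψ₄(A)Ag_k), φ₂ = (uᵀψ₁(A)g_k)(vᵀψ₂(A)Ag_k) + (uᵀψ₁(A)Ag_k)(vᵀψ₂(A)g_k) − (uᵀψ₃(A)g_k)(vᵀψ₄(A)Ag_k) − (uᵀψ₃(A)Ag_k)(vᵀψ₄(A)g_k), φ₃ = (uᵀψ₁(A)g_k)(vᵀψ₂(A)g_k) − (uᵀψ₃(A)g_k)(vᵀψ₄(A)g_k). Then φ₁ = ζ_{k−2,2}·ζ_{k−1,2}·α_{k−1}·(α_{k−1}^{BB2} − α_k^{BB2}), φ₂ = ζ_{k−2,2}·ζ_{k−1,2}·α_{k−1}·(α_{k−1}^{BB1}α_{k−1}^{BB2} − α_k^{BB1}α_k^{BB2}),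 and φ₃ = ζ_{k−2,1}·ζ_{k−1,1}·α_{k−1}·(α_{k−1}^{BB1} − α_k^{BB1}). -/
open Matrix

/-- `A` commutes with the gradient step `1 - a • A`. -/
theorem mulVec_one_sub_smul_comm {n : ℕ} (A : Matrix (Fin n) (Fin n) ℝ) (a : ℝ)
    (x : Fin n → ℝ) :
    A *ᵥ ((1 - a • A) *ᵥ x) = (1 - a • A) *ᵥ (A *ᵥ x) := by
  simp [mul_sub, sub_mul]

/-- Gradient steps with the same Hessian commute. -/
theorem one_sub_smul_mulVec_comm {n : ℕ} (A : Matrix (Fin n) (Fin n) ℝ) (a b : ℝ)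
    (x : Fin n → ℝ) :
    (1 - a • A) *ᵥ ((1 - b • A) *ᵥ x) = (1 - b • A) *ᵥ ((1 - a • A) *ᵥ x) := by
  rw [mulVec_mulVec, mulVec_mulVec]
  congr 1
  exact ((Commute.one_left _).sub_left
    (((Commute.one_right A).sub_right ((Commute.refl A).smul_right b)).smul_left a)).eq

theorem inv_mulVec_mulVec_cancel {n : ℕ} {M : Matrix (Fin n) (Fin n) ℝ} (hM : IsUnit M)
    (x : Fin n → ℝ) : M⁻¹ *ᵥ (M *ᵥ x) = x := by
  rw [mulVec_mulVec, nonsing_inv_mul _ ((isUnit_iff_isUnit_det M).mp hM), one_mulVec]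

theorem dotProduct_one_sub_smul_mulVec {n : ℕ} (A : Matrix (Fin n) (Fin n) ℝ) (a : ℝ)
    (x y : Fin n → ℝ) :
    x ⬝ᵥ ((1 - a • A) *ᵥ y) = x ⬝ᵥ y - a * (x ⬝ᵥ (A *ᵥ y)) := by
  simp [sub_mulVec, smul_mulVec, dotProduct_sub, dotProduct_smul]

/-- Closed-form expressions, from the proof of Theorem 2.3, for the coefficients
`φ₁, φ₂, φ₃` of the quadratic equation obtained by expanding the
quadratic-termination equation (2.12) in the stepsize `α`. -/
theorem stmt_10 {n : ℕ} (A : Matrix (Fin n) (Fin n) ℝ) (hA : A.IsSymm)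
    (gkm2 : Fin n → ℝ) (αkm2 αkm1 : ℝ)
    (hinv2 : IsUnit (1 - αkm2 • A)) (hinv1 : IsUnit (1 - αkm1 • A))
    (gkm1 gk : Fin n → ℝ)
    (hgkm1 : gkm1 = (1 - αkm2 • A) *ᵥ gkm2)
    (hgk : gk = (1 - αkm1 • A) *ᵥ gkm1)
    (z20 z21 z22 z10 z11 z12 : ℝ)
    (hz20 : z20 = gkm2 ⬝ᵥ (A ^ 0 *ᵥ gkm2))
    (hz21 : z21 = gkm2 ⬝ᵥ (A ^ 1 *ᵥ gkm2))
    (hz22 : z22 = gkm2 ⬝ᵥ (A ^ 2 *ᵥ gkm2))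
    (hz10 : z10 = gkm1 ⬝ᵥ (A ^ 0 *ᵥ gkm1))
    (hz11 : z11 = gkm1 ⬝ᵥ (A ^ 1 *ᵥ gkm1))
    (hz12 : z12 = gkm1 ⬝ᵥ (A ^ 2 *ᵥ gkm1))
    (hz21ne : z21 ≠ 0) (hz22ne : z22 ≠ 0) (hz11ne : z11 ≠ 0) (hz12ne : z12 ≠ 0)
    (a1 b1 a2 b2 : ℝ)
    (ha1 : a1 = z20 / z21) (hb1 : b1 = z21 / z22)
    (ha2 : a2 = z10 / z11) (hb2 : b2 = z11 / z12)
    (φ₁ φ₂ φ₃ : ℝ)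
    (hφ₁ : φ₁ =
      (gkm2 ⬝ᵥ ((1 - αkm2 • A)⁻¹ *ᵥ (A *ᵥ gk))) *
        (gkm1 ⬝ᵥ ((1 - αkm1 • A)⁻¹ *ᵥ (A *ᵥ gk))) -
      (gkm2 ⬝ᵥ ((1 - αkm2 • A)⁻¹ *ᵥ ((1 - αkm1 • A)⁻¹ *ᵥ (A *ᵥ gk)))) *
        (gkm1 ⬝ᵥ (A *ᵥ gk)))
    (hφ₂ : φ₂ =
      (gkm2 ⬝ᵥ ((1 - αkm2 • A)⁻¹ *ᵥ gk)) *
        (gkm1 ⬝ᵥ ((1 - αkm1 • A)⁻¹ *ᵥ (A *ᵥ gk))) +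
      (gkm2 ⬝ᵥ ((1 - αkm2 • A)⁻¹ *ᵥ (A *ᵥ gk))) *
        (gkm1 ⬝ᵥ ((1 - αkm1 • A)⁻¹ *ᵥ gk)) -
      (gkm2 ⬝ᵥ ((1 - αkm2 • A)⁻¹ *ᵥ ((1 - αkm1 • A)⁻¹ *ᵥ gk))) *
        (gkm1 ⬝ᵥ (A *ᵥ gk)) -
      (gkm2 ⬝ᵥ ((1 - αkm2 • A)⁻¹ *ᵥ ((1 - αkm1 • A)⁻¹ *ᵥ (A *ᵥ gk)))) *
        (gkm1 ⬝ᵥ gk))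
    (hφ₃ : φ₃ =
      (gkm2 ⬝ᵥ ((1 - αkm2 • A)⁻¹ *ᵥ gk)) *
        (gkm1 ⬝ᵥ ((1 - αkm1 • A)⁻¹ *ᵥ gk)) -
      (gkm2 ⬝ᵥ ((1 - αkm2 • A)⁻¹ *ᵥ ((1 - αkm1 • A)⁻¹ *ᵥ gk))) *
        (gkm1 ⬝ᵥ gk)) :
    φ₁ = z22 * z12 * αkm1 * (b1 - b2) ∧
    φ₂ = z22 * z12 * αkm1 * (a1 * b1 - a2 * b2) ∧
    φ₃ = z21 * z11 * αkm1 * (a1 - a2) := by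
  have hAgk : A *ᵥ gk = (1 - αkm1 • A) *ᵥ (A *ᵥ gkm1) := by
    rw [hgk, mulVec_one_sub_smul_comm]
  have hAgkm1 : A *ᵥ gkm1 = (1 - αkm2 • A) *ᵥ (A *ᵥ gkm2) := by
    rw [hgkm1, mulVec_one_sub_smul_comm]
  have h1 : (1 - αkm2 • A)⁻¹ *ᵥ gk = (1 - αkm1 • A) *ᵥ gkm2 := by
    rw [hgk, hgkm1, one_sub_smul_mulVec_comm, inv_mulVec_mulVec_cancel hinv2]
  have h1A : (1 - αkm2 • A)⁻¹ *ᵥ (A *ᵥ gk) = (1 - αkm1 • A) *ᵥ (A *ᵥ gkm2) := by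
    rw [hAgk, hAgkm1, one_sub_smul_mulVec_comm, inv_mulVec_mulVec_cancel hinv2]
  have h2 : (1 - αkm1 • A)⁻¹ *ᵥ gk = gkm1 := by
    rw [hgk, inv_mulVec_mulVec_cancel hinv1]
  have h2A : (1 - αkm1 • A)⁻¹ *ᵥ (A *ᵥ gk) = A *ᵥ gkm1 := by
    rw [hAgk, inv_mulVec_mulVec_cancel hinv1]
  have h3 : (1 - αkm2 • A)⁻¹ *ᵥ gkm1 = gkm2 := by
    rw [hgkm1, inv_mulVec_mulVec_cancel hinv2]
  have h3A : (1 - αkm2 • A)⁻¹ *ᵥ (A *ᵥ gkm1) = A *ᵥ gkm2 := by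
    rw [hAgkm1, inv_mulVec_mulVec_cancel hinv2]
  rw [h1A, h2A, h3A, hAgk] at hφ₁
  rw [h1, h1A, h2, h2A, h3, h3A, hAgk, hgk] at hφ₂
  rw [h1, h2, h3, hgk] at hφ₃
  simp only [dotProduct_one_sub_smul_mulVec] at hφ₁ hφ₂ hφ₃
  rw [pow_zero, one_mulVec] at hz20 hz10
  rw [pow_one] at hz21 hz11
  rw [pow_two, ← mulVec_mulVec] at hz22 hz12
  rw [← hz21, ← hz22, ← hz11, ← hz12] at hφ₁
  rw [← hz20, ← hz21, ← hz22, ← hz10, ← hz11, ← hz12] at hφ₂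
  rw [← hz20, ← hz21, ← hz10, ← hz11] at hφ₃
  subst hφ₁ hφ₂ hφ₃ ha1 hb1 ha2 hb2
  refine ⟨?_, ?_, ?_⟩ <;> field_simp <;> ring
end

section
/- Let A be an n×n real symmetric positive definite matrix and let g, h ∈ ℝⁿ be nonzero. Define a₁ = (gᵀg)/(gᵀAg), b₁ = (gᵀAg)/(gᵀA²g), a₂ = (hᵀh)/(hᵀAh), b₂ = (hᵀAh)/(hᵀA²h), and assume a₁ ≠ a₂. Set r₁ = (b₁ − b₂)/(b₁·b₂·(a₁ − a₂)) and r₂ = (a₁b₁ − a₂b₂)/(b₁·b₂·(a₁ − a₂)). Then r₂² − 4r₁ ≥ 0. -/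
open Matrix

/-- For a symmetric positive definite matrix, the second Barzilai–Borwein stepsize is
nonnegative and bounded by the first one. -/
theorem Matrix.PosDef.div_dotProduct_le_div_dotProduct {ι : Type*} [Fintype ι] [DecidableEq ι]
    {A : Matrix ι ι ℝ} (hA : A.PosDef) {g : ι → ℝ} (hg : g ≠ 0) :
    0 ≤ (g ⬝ᵥ (A *ᵥ g)) / (g ⬝ᵥ (A ^ 2 *ᵥ g)) ∧
      (g ⬝ᵥ (A *ᵥ g)) / (g ⬝ᵥ (A ^ 2 *ᵥ g)) ≤ (g ⬝ᵥ g) / (g ⬝ᵥ (A *ᵥ g)) := by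
  have hp : 0 < g ⬝ᵥ (A *ᵥ g) := by simpa using hA.dotProduct_mulVec_pos hg
  have hsymm : Aᵀ = A := by simpa using hA.isHermitian.eq
  have hsq : g ⬝ᵥ (A ^ 2 *ᵥ g) = (A *ᵥ g) ⬝ᵥ (A *ᵥ g) := by
    rw [pow_two, ← mulVec_mulVec, dotProduct_mulVec, ← mulVec_transpose, hsymm]
  have hcs : (g ⬝ᵥ (A *ᵥ g)) ^ 2 ≤ (g ⬝ᵥ g) * ((A *ᵥ g) ⬝ᵥ (A *ᵥ g)) := by
    simpa only [dotProduct, pow_two] using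
      Finset.sum_mul_sq_le_sq_mul_sq Finset.univ g (A *ᵥ g)
  have hgg : 0 ≤ g ⬝ᵥ g := Finset.sum_nonneg fun i _ => mul_self_nonneg (g i)
  have hq : 0 < (A *ᵥ g) ⬝ᵥ (A *ᵥ g) := by
    by_contra! hle
    nlinarith [pow_pos hp 2]
  rw [hsq]
  refine ⟨by positivity, ?_⟩
  rw [div_le_div_iff₀ hq hp]
  linarith

/-- Completing the square at `b1` shows that the discriminant is nonnegative. -/
theorem four_mul_le_sq_of_le {a1 b1 : ℝ} (a2 b2 : ℝ) (hb : 0 ≤ b1) (hab : b1 ≤ a1) :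
    0 ≤ (a1 * b1 - a2 * b2) ^ 2 - 4 * ((b1 - b2) * (b1 * b2 * (a1 - a2))) := by
  have hmul : 0 ≤ b1 * (b1 - b2) ^ 2 * (a1 - b1) :=
    mul_nonneg (mul_nonneg hb (sq_nonneg _)) (sub_nonneg.2 hab)
  linear_combination sq_nonneg (2 * (b1 - b2) * b1 - (a1 * b1 - a2 * b2)) + 4 * hmul

/-- Well-definedness assertion of Theorem 2.4: the radicand `r₂² − 4r₁` of the new
stepsize is nonnegative. -/
theorem stmt_11 {n : ℕ} (A : Matrix (Fin n) (Fin n) ℝ) (hA : A.PosDef)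
    (g h : Fin n → ℝ) (hg : g ≠ 0) (hh : h ≠ 0)
    (a1 b1 a2 b2 : ℝ)
    (ha1 : a1 = (g ⬝ᵥ g) / (g ⬝ᵥ (A *ᵥ g)))
    (hb1 : b1 = (g ⬝ᵥ (A *ᵥ g)) / (g ⬝ᵥ (A ^ 2 *ᵥ g)))
    (ha2 : a2 = (h ⬝ᵥ h) / (h ⬝ᵥ (A *ᵥ h)))
    (hb2 : b2 = (h ⬝ᵥ (A *ᵥ h)) / (h ⬝ᵥ (A ^ 2 *ᵥ h)))
    (hne : a1 ≠ a2)
    (r1 r2 : ℝ)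
    (hr1 : r1 = (b1 - b2) / (b1 * b2 * (a1 - a2)))
    (hr2 : r2 = (a1 * b1 - a2 * b2) / (b1 * b2 * (a1 - a2))) :
    0 ≤ r2 ^ 2 - 4 * r1 := by
  obtain ⟨hb, hab⟩ := hA.div_dotProduct_le_div_dotProduct hg
  rw [← ha1, ← hb1] at hab
  rw [← hb1] at hb
  have hdisc := four_mul_le_sq_of_le a2 b2 hb hab
  rw [hr1, hr2]
  by_cases hd : b1 * b2 * (a1 - a2) = 0
  · simp [hd]
  · have heq : ((a1 * b1 - a2 * b2) / (b1 * b2 * (a1 - a2))) ^ 2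
        - 4 * ((b1 - b2) / (b1 * b2 * (a1 - a2)))
        = ((a1 * b1 - a2 * b2) ^ 2 - 4 * ((b1 - b2) * (b1 * b2 * (a1 - a2))))
          / (b1 * b2 * (a1 - a2)) ^ 2 := by
      generalize b1 * b2 * (a1 - a2) = d at hd
      field_simp
    rw [heq]
    exact div_nonneg hdisc (sq_nonneg _)
end

section
/- Let A be an n×n real symmetric positive definite matrix and let g, h ∈ ℝⁿ be nonzero. Define a₁ = (gᵀg)/(gᵀAg), b₁ = (gᵀAg)/(gᵀA²g), a₂ = (hᵀh)/(hᵀAh), b₂ = (hᵀAh)/(hᵀA²h), and assume a₁ ≠ a₂. Set r₁ = (b₁ − b₂)/(b₁·b₂·(a₁ − a₂)), r₂ = (a₁b₁ − a₂b₂)/(b₁·b₂·(a₁ − a₂)), and α^{new} = 2/(r₂ + √(r₂² − 4r₁)). If r₁ ≥ 0 and r₂ ≠ 0, then 1/r₂ ≤ α^{new} ≤ min{b₁, b₂}. -/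
open Matrix

/-- The Barzilai–Borwein stepsizes of a positive definite matrix satisfy `0 < BB2 ≤ BB1`. -/
theorem Matrix.PosDef.bb2_pos_and_le_bb1 {ι : Type*} [Fintype ι] [DecidableEq ι]
    {A : Matrix ι ι ℝ} (hA : A.PosDef) {v : ι → ℝ} (hv : v ≠ 0) :
    0 < (v ⬝ᵥ (A *ᵥ v)) / (v ⬝ᵥ (A ^ 2 *ᵥ v)) ∧
      (v ⬝ᵥ (A *ᵥ v)) / (v ⬝ᵥ (A ^ 2 *ᵥ v)) ≤ (v ⬝ᵥ v) / (v ⬝ᵥ (A *ᵥ v)) := by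
  have hquad : 0 < v ⬝ᵥ (A *ᵥ v) := by simpa using hA.dotProduct_mulVec_pos hv
  have hsymm : Aᵀ = A := by simpa using hA.isHermitian.eq
  have hsq : v ⬝ᵥ (A ^ 2 *ᵥ v) = (A *ᵥ v) ⬝ᵥ (A *ᵥ v) := by
    rw [pow_two, ← mulVec_mulVec, dotProduct_mulVec, ← mulVec_transpose, hsymm]
  have hcs : (v ⬝ᵥ (A *ᵥ v)) ^ 2 ≤ (v ⬝ᵥ v) * ((A *ᵥ v) ⬝ᵥ (A *ᵥ v)) := by
    simpa [dotProduct, pow_two] using Finset.sum_mul_sq_le_sq_mul_sq Finset.univ v (A *ᵥ v)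
  have hpos : 0 < (A *ᵥ v) ⬝ᵥ (A *ᵥ v) := by
    have hne : A *ᵥ v ≠ 0 := fun h0 => by simp [h0] at hquad
    simpa using dotProduct_star_self_pos_iff.2 hne
  rw [hsq]
  refine ⟨div_pos hquad hpos, ?_⟩
  rw [div_le_div_iff₀ hpos hquad]
  nlinarith

/-- The smaller root `2 / (r + √(r² - 4q))` of `q x² - r x + 1` lies between `1 / r` and any
positive point where the quadratic is nonpositive. -/
theorem one_div_le_and_smaller_root_le {q r b : ℝ} (hq : 0 ≤ q) (hr : 0 < r) (hb : 0 < b)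
    (hroot : q * b ^ 2 - r * b + 1 ≤ 0) :
    1 / r ≤ 2 / (r + √(r ^ 2 - 4 * q)) ∧ 2 / (r + √(r ^ 2 - 4 * q)) ≤ b := by
  have hs := Real.sqrt_nonneg (r ^ 2 - 4 * q)
  have hsr : √(r ^ 2 - 4 * q) ≤ r := Real.sqrt_le_iff.2 ⟨hr.le, by linarith⟩
  refine ⟨?_, ?_⟩
  · rw [div_le_div_iff₀ hr (by linarith)]
    linarith
  · have hle : (2 / b - r) ≤ √(r ^ 2 - 4 * q) := by
      refine Real.le_sqrt_of_sq_le ?_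
      have hdiff : (2 / b - r) ^ 2 - (r ^ 2 - 4 * q) = 4 * (q * b ^ 2 - r * b + 1) / b ^ 2 := by
        field_simp
        ring
      have : 4 * (q * b ^ 2 - r * b + 1) / b ^ 2 ≤ 0 :=
        div_nonpos_of_nonpos_of_nonneg (by linarith) (sq_nonneg b)
      linarith
    rw [div_le_comm₀ (by linarith) hb]
    linarith

/-- The stepsize bounds in the case `a₂ < a₁`. -/
theorem stepsize_bounds_of_lt {a₁ b₁ a₂ b₂ : ℝ} (hb₁ : 0 < b₁) (hb₂ : 0 < b₂)
    (hba₂ : b₂ ≤ a₂) (hlt : a₂ < a₁) {q r : ℝ}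
    (hq : q = (b₁ - b₂) / (b₁ * b₂ * (a₁ - a₂)))
    (hr : r = (a₁ * b₁ - a₂ * b₂) / (b₁ * b₂ * (a₁ - a₂))) (hq0 : 0 ≤ q) :
    1 / r ≤ 2 / (r + √(r ^ 2 - 4 * q)) ∧ 2 / (r + √(r ^ 2 - 4 * q)) ≤ min b₁ b₂ := by
  have hd : 0 < a₁ - a₂ := sub_pos.2 hlt
  have hD : 0 < b₁ * b₂ * (a₁ - a₂) := by positivity
  have hb : b₂ ≤ b₁ := by
    rw [hq, le_div_iff₀ hD] at hq0
    linarith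
  have hr0 : 0 < r := by
    rw [hr]
    exact div_pos (by nlinarith) hD
  rw [min_eq_right hb]
  refine one_div_le_and_smaller_root_le hq0 hr0 hb₂ ?_
  have hval : q * b₂ ^ 2 - r * b₂ + 1 = (b₁ - b₂) * (b₂ - a₂) / (b₁ * (a₁ - a₂)) := by
    rw [hq, hr]
    field_simp
    ring
  rw [hval]
  exact div_nonpos_of_nonpos_of_nonneg
    (mul_nonpos_of_nonneg_of_nonpos (sub_nonneg.2 hb) (sub_nonpos.2 hba₂)) (by positivity)

/-- First bound of Theorem 2.4 (inequality (2.19)): if `r₁ ≥ 0` and `r₂ ≠ 0`, then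
`1/r₂ ≤ α^{new} ≤ min{b₁, b₂}`. -/
theorem stmt_12 {n : ℕ} (A : Matrix (Fin n) (Fin n) ℝ) (hA : A.PosDef)
    (g h : Fin n → ℝ) (hg : g ≠ 0) (hh : h ≠ 0)
    (a1 b1 a2 b2 : ℝ)
    (ha1 : a1 = (g ⬝ᵥ g) / (g ⬝ᵥ (A *ᵥ g)))
    (hb1 : b1 = (g ⬝ᵥ (A *ᵥ g)) / (g ⬝ᵥ (A ^ 2 *ᵥ g)))
    (ha2 : a2 = (h ⬝ᵥ h) / (h ⬝ᵥ (A *ᵥ h)))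
    (hb2 : b2 = (h ⬝ᵥ (A *ᵥ h)) / (h ⬝ᵥ (A ^ 2 *ᵥ h)))
    (hne : a1 ≠ a2)
    (r1 r2 αnew : ℝ)
    (hr1 : r1 = (b1 - b2) / (b1 * b2 * (a1 - a2)))
    (hr2 : r2 = (a1 * b1 - a2 * b2) / (b1 * b2 * (a1 - a2)))
    (hαnew : αnew = 2 / (r2 + Real.sqrt (r2 ^ 2 - 4 * r1)))
    (hr1pos : 0 ≤ r1) (hr2ne : r2 ≠ 0) :
    1 / r2 ≤ αnew ∧ αnew ≤ min b1 b2 := by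
  obtain ⟨hb1pos, hba1⟩ := hA.bb2_pos_and_le_bb1 hg
  obtain ⟨hb2pos, hba2⟩ := hA.bb2_pos_and_le_bb1 hh
  rw [← hb1] at hb1pos hba1
  rw [← hb2] at hb2pos hba2
  rw [← ha1] at hba1
  rw [← ha2] at hba2
  rw [hαnew]
  rcases hne.lt_or_gt with hlt | hlt
  · rw [min_comm]
    refine stepsize_bounds_of_lt hb2pos hb1pos hba1 hlt ?_ ?_ hr1pos
    · rw [hr1, ← neg_div_neg_eq]
      congr 1 <;> ring
    · rw [hr2, ← neg_div_neg_eq]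
      congr 1 <;> ring
  · exact stepsize_bounds_of_lt hb1pos hb2pos hba2 hlt hr1 hr2 hr1pos
end

section
/- Let λ₁ > 0, κ > 1 and c ∈ ℝ with c² ≠ 1, and set λ_n = κ·λ₁. Let (a_k) and (b_k) be real sequences such that, as k → ∞, a_{2k} → (1+c²)/(λ₁(κ+c²)), a_{2k+1} → (1+c²)/(λ₁(1+c²κ)), b_{2k} → (κ+c²)/(λ₁(κ²+c²)) and b_{2k+1} → (1+c²κ)/(λ₁(1+c²κ²)). Define r₁(k) = (b_{k−1} − b_k)/(b_{k−1}·b_k·(a_{k−1} − a_k)), r₂(k) = (a_{k−1}b_{k−1} − a_k·b_k)/(b_{k−1}·b_k·(a_{k−1} − a_k)) and α_k^{new} = 2/(r₂(k) + √(r₂(k)² − 4·r₁(k))). Then α_k^{new} → 1/λ_n as k → ∞. -/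
open Filter

/-- A sequence converges as soon as its subsequences of even and of odd index converge to the
same limit. -/
theorem tendsto_atTop_of_tendsto_even_odd {X : Type*} {f : ℕ → X} {l : Filter X}
    (h0 : Tendsto (fun k => f (2 * k)) atTop l)
    (h1 : Tendsto (fun k => f (2 * k + 1)) atTop l) : Tendsto f atTop l := by
  intro s hs
  obtain ⟨M, hM⟩ := eventually_atTop.1 (h0.eventually_mem hs)
  obtain ⟨N, hN⟩ := eventually_atTop.1 (h1.eventually_mem hs)
  refine eventually_atTop.2 ⟨2 * M + 2 * N + 1, fun n hn => ?_⟩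
  obtain ⟨m, rfl | rfl⟩ := n.even_or_odd'
  · exact hM m (by lia)
  · exact hN m (by lia)

/-- If consecutive stepsize pairs converge to `(A, B)` and `(A', B')`, and the limiting values of
the product and the sum of the two roots are `p * q` and `p + q` with `0 < p < q`, then the
reciprocal of the larger root converges to `1 / q`. -/
theorem tendsto_two_div_add_sqrt {ι : Type*} {l : Filter ι} {x y u v : ι → ℝ}
    {A A' B B' p q : ℝ} (hp : 0 < p) (hpq : p < q) (hA : A ≠ A') (hB : B ≠ 0) (hB' : B' ≠ 0)
    (h1 : B - B' = p * q * (B * B' * (A - A')))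
    (h2 : A * B - A' * B' = (p + q) * (B * B' * (A - A')))
    (hx : Tendsto x l (nhds A)) (hy : Tendsto y l (nhds A'))
    (hu : Tendsto u l (nhds B)) (hv : Tendsto v l (nhds B')) :
    Tendsto (fun i => 2 / ((x i * u i - y i * v i) / (u i * v i * (x i - y i)) +
      Real.sqrt (((x i * u i - y i * v i) / (u i * v i * (x i - y i))) ^ 2 -
        4 * ((u i - v i) / (u i * v i * (x i - y i)))))) l (nhds (1 / q)) := by
  have hD : B * B' * (A - A') ≠ 0 := mul_ne_zero (mul_ne_zero hB hB') (sub_ne_zero.2 hA)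
  have hden := (hu.mul hv).mul (hx.sub hy)
  have hr1 := (hu.sub hv).div hden hD
  have hr2 := ((hx.mul hu).sub (hy.mul hv)).div hden hD
  rw [h1, mul_div_cancel_right₀ _ hD] at hr1
  rw [h2, mul_div_cancel_right₀ _ hD] at hr2
  have hsqrt : Real.sqrt ((p + q) ^ 2 - 4 * (p * q)) = q - p := by
    rw [show (p + q) ^ 2 - 4 * (p * q) = (q - p) ^ 2 by ring, Real.sqrt_sq (by linarith)]
  have hsum : p + q + Real.sqrt ((p + q) ^ 2 - 4 * (p * q)) = 2 * q := by
    rw [hsqrt]; ring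
  have hq : q ≠ 0 := by linarith
  have key := (tendsto_const_nhds (x := (2 : ℝ))).div
    (hr2.add ((hr2.pow 2).sub (hr1.const_mul 4)).sqrt) (by rw [hsum]; positivity)
  rw [hsum, show 2 / (2 * q) = 1 / q by field_simp] at key
  exact key

/-- Theorem 2.5: under the subsequential limits of the Barzilai–Borwein stepsizes of
the steepest descent method, the new stepsize converges to `1/λ_n`. -/
theorem stmt_16 (lam1 kappa c : ℝ) (hlam1 : 0 < lam1) (hkappa : 1 < kappa)
    (hc : c ^ 2 ≠ 1) (lamn : ℝ) (hlamn : lamn = kappa * lam1)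
    (a b : ℕ → ℝ)
    (ha0 : Tendsto (fun k => a (2 * k)) atTop
      (nhds ((1 + c ^ 2) / (lam1 * (kappa + c ^ 2)))))
    (ha1 : Tendsto (fun k => a (2 * k + 1)) atTop
      (nhds ((1 + c ^ 2) / (lam1 * (1 + c ^ 2 * kappa)))))
    (hb0 : Tendsto (fun k => b (2 * k)) atTop
      (nhds ((kappa + c ^ 2) / (lam1 * (kappa ^ 2 + c ^ 2)))))
    (hb1 : Tendsto (fun k => b (2 * k + 1)) atTop
      (nhds ((1 + c ^ 2 * kappa) / (lam1 * (1 + c ^ 2 * kappa ^ 2)))))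
    (r1 r2 αnew : ℕ → ℝ)
    (hr1 : ∀ k, r1 k = (b (k - 1) - b k) / (b (k - 1) * b k * (a (k - 1) - a k)))
    (hr2 : ∀ k, r2 k =
      (a (k - 1) * b (k - 1) - a k * b k) / (b (k - 1) * b k * (a (k - 1) - a k)))
    (hαnew : ∀ k, αnew k = 2 / (r2 k + Real.sqrt ((r2 k) ^ 2 - 4 * r1 k))) :
    Tendsto αnew atTop (nhds (1 / lamn)) := by
  have hk : 0 < kappa := by linarith
  have hs : 0 ≤ c ^ 2 := sq_nonneg c
  generalize c ^ 2 = s at *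
  have e1 : 0 < kappa + s := by positivity
  have e2 : 0 < 1 + s * kappa := by positivity
  have e3 : 0 < kappa ^ 2 + s := by positivity
  have e4 : 0 < 1 + s * kappa ^ 2 := by positivity
  subst hlamn
  have hlt : lam1 < kappa * lam1 := by nlinarith
  set A := (1 + s) / (lam1 * (kappa + s)) with hAdef
  set A' := (1 + s) / (lam1 * (1 + s * kappa)) with hA'def
  set B := (kappa + s) / (lam1 * (kappa ^ 2 + s)) with hBdef
  set B' := (1 + s * kappa) / (lam1 * (1 + s * kappa ^ 2)) with hB'def
  have hB : B ≠ 0 := by positivity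
  have hB' : B' ≠ 0 := by positivity
  have hA : A ≠ A' := by
    rw [hAdef, hA'def, Ne, div_eq_div_iff (by positivity) (by positivity)]
    intro h
    have h' : (1 + s) * lam1 * ((kappa - 1) * (s - 1)) = 0 := by linear_combination h
    exact mul_ne_zero (by positivity)
      (mul_ne_zero (sub_ne_zero.2 hkappa.ne') (sub_ne_zero.2 hc)) h'
  have h1 : B - B' = lam1 * (kappa * lam1) * (B * B' * (A - A')) := by
    rw [hAdef, hA'def, hBdef, hB'def]
    field_simp
    ring
  have h2 : A * B - A' * B' = (lam1 + kappa * lam1) * (B * B' * (A - A')) := by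
    rw [hAdef, hA'def, hBdef, hB'def]
    field_simp
    ring
  obtain rfl : αnew = _ := funext hαnew
  simp only [hr1, hr2]
  refine tendsto_atTop_of_tendsto_even_odd ?_ ?_
  · rw [← tendsto_add_atTop_iff_nat 1]
    exact tendsto_two_div_add_sqrt hlam1 hlt hA.symm hB' hB
      (by linear_combination -h1) (by linear_combination -h2)
      ha1 ((tendsto_add_atTop_iff_nat 1).2 ha0) hb1 ((tendsto_add_atTop_iff_nat 1).2 hb0)
  · exact tendsto_two_div_add_sqrt hlam1 hlt hA hB hB' h1 h2 ha0 ha1 hb0 hb1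
end

section
/- Let λ₁ > 0, κ > 1 and c ∈ ℝ with c² ≠ 1, and set λ_n = κ·λ₁. Let (a_k) and (b_k) be real sequences such that, as k → ∞, a_{2k} → (1+c²)/(λ₁(κ+c²)), a_{2k+1} → (1+c²)/(λ₁(1+c²κ)), b_{2k} → (κ+c²)/(λ₁(κ²+c²)) and b_{2k+1} → (1+c²κ)/(λ₁(1+c²κ²)). Define r₁(k) = (b_{k−1} − b_k)/(b_{k−1}·b_k·(a_{k−1} − a_k)) and r₂(k) = (a_{k−1}b_{k−1} − a_k·b_k)/(b_{k−1}·b_k·(a_{k−1} − a_k)). Then r₁(k) → λ₁·λ_n and r₂(k) → λ₁ + λ_n as k → ∞. -/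
open Filter

/-- A sequence converges along `atTop` if its even and odd subsequences converge to the
same limit. -/
theorem tendsto_atTop_of_even_of_odd {α : Type*} {u : ℕ → α} {l : Filter α}
    (h0 : Tendsto (fun k => u (2 * k)) atTop l)
    (h1 : Tendsto (fun k => u (2 * k + 1)) atTop l) : Tendsto u atTop l := by
  intro s hs
  obtain ⟨m, hm⟩ := mem_atTop_sets.1 (h0 hs)
  obtain ⟨n, hn⟩ := mem_atTop_sets.1 (h1 hs)
  refine mem_atTop_sets.2 ⟨2 * (m + n) + 1, fun k hk => ?_⟩
  obtain ⟨j, rfl | rfl⟩ := k.even_or_odd'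
  · exact hm j (by lia)
  · exact hn j (by lia)

/-- The two displayed limits in the proof of Theorem 2.5:
`r₁(k) → λ₁λ_n` and `r₂(k) → λ₁ + λ_n`. -/
theorem stmt_17 (lam1 kappa c : ℝ) (hlam1 : 0 < lam1) (hkappa : 1 < kappa)
    (hc : c ^ 2 ≠ 1) (lamn : ℝ) (hlamn : lamn = kappa * lam1)
    (a b : ℕ → ℝ)
    (ha0 : Tendsto (fun k => a (2 * k)) atTop
      (nhds ((1 + c ^ 2) / (lam1 * (kappa + c ^ 2)))))
    (ha1 : Tendsto (fun k => a (2 * k + 1)) atTop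
      (nhds ((1 + c ^ 2) / (lam1 * (1 + c ^ 2 * kappa)))))
    (hb0 : Tendsto (fun k => b (2 * k)) atTop
      (nhds ((kappa + c ^ 2) / (lam1 * (kappa ^ 2 + c ^ 2)))))
    (hb1 : Tendsto (fun k => b (2 * k + 1)) atTop
      (nhds ((1 + c ^ 2 * kappa) / (lam1 * (1 + c ^ 2 * kappa ^ 2)))))
    (r1 r2 : ℕ → ℝ)
    (hr1 : ∀ k, r1 k = (b (k - 1) - b k) / (b (k - 1) * b k * (a (k - 1) - a k)))
    (hr2 : ∀ k, r2 k =
      (a (k - 1) * b (k - 1) - a k * b k) / (b (k - 1) * b k * (a (k - 1) - a k))) :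
    Tendsto r1 atTop (nhds (lam1 * lamn)) ∧ Tendsto r2 atTop (nhds (lam1 + lamn)) := by
  subst hlamn
  have hk : 0 < kappa := by linarith
  have hd0 : kappa + c ^ 2 ≠ 0 := by positivity
  have hd1 : 1 + c ^ 2 * kappa ≠ 0 := by positivity
  have he0 : kappa ^ 2 + c ^ 2 ≠ 0 := by positivity
  have he1 : 1 + c ^ 2 * kappa ^ 2 ≠ 0 := by positivity
  have hl : lam1 ≠ 0 := hlam1.ne'
  set A0 := (1 + c ^ 2) / (lam1 * (kappa + c ^ 2)) with hA0
  set A1 := (1 + c ^ 2) / (lam1 * (1 + c ^ 2 * kappa)) with hA1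
  set B0 := (kappa + c ^ 2) / (lam1 * (kappa ^ 2 + c ^ 2)) with hB0
  set B1 := (1 + c ^ 2 * kappa) / (lam1 * (1 + c ^ 2 * kappa ^ 2)) with hB1
  have hA : A0 - A1 ≠ 0 := by
    have h : A0 - A1 = (1 + c ^ 2) * (1 - kappa) * (1 - c ^ 2) /
        (lam1 * (kappa + c ^ 2) * (1 + c ^ 2 * kappa)) := by
      rw [hA0, hA1]; field_simp; ring
    rw [h]
    have : 1 + c ^ 2 ≠ 0 := by positivity
    have : 1 - kappa ≠ 0 := by linarith
    have : 1 - c ^ 2 ≠ 0 := sub_ne_zero.2 hc.symm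
    positivity
  have hA' : A1 - A0 ≠ 0 := by rwa [← neg_sub, neg_ne_zero]
  have hB0' : B0 ≠ 0 := by positivity
  have hB1' : B1 ≠ 0 := by positivity
  have key1 : B0 - B1 = lam1 * (kappa * lam1) * (B0 * B1 * (A0 - A1)) := by
    rw [hA0, hA1, hB0, hB1]; field_simp; ring
  have key2 : A0 * B0 - A1 * B1 = (lam1 + kappa * lam1) * (B0 * B1 * (A0 - A1)) := by
    rw [hA0, hA1, hB0, hB1]; field_simp; ring
  have hD : B0 * B1 * (A0 - A1) ≠ 0 := mul_ne_zero (mul_ne_zero hB0' hB1') hA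
  have hD' : B1 * B0 * (A1 - A0) ≠ 0 := mul_ne_zero (mul_ne_zero hB1' hB0') hA'
  have ha0' := (tendsto_add_atTop_iff_nat 1).2 ha0
  have hb0' := (tendsto_add_atTop_iff_nat 1).2 hb0
  have hpred (k : ℕ) : 2 * (k + 1) - 1 = 2 * k + 1 := by lia
  constructor
  · apply tendsto_atTop_of_even_of_odd
    · rw [← tendsto_add_atTop_iff_nat 1]
      simp only [hr1, hpred]
      rw [show lam1 * (kappa * lam1) = (B1 - B0) / (B1 * B0 * (A1 - A0)) by
        rw [eq_div_iff hD']; linear_combination key1]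
      exact (hb1.sub hb0').div ((hb1.mul hb0').mul (ha1.sub ha0')) hD'
    · simp only [hr1, Nat.add_sub_cancel]
      rw [show lam1 * (kappa * lam1) = (B0 - B1) / (B0 * B1 * (A0 - A1)) by
        rw [eq_div_iff hD]; linear_combination -key1]
      exact (hb0.sub hb1).div ((hb0.mul hb1).mul (ha0.sub ha1)) hD
  · apply tendsto_atTop_of_even_of_odd
    · rw [← tendsto_add_atTop_iff_nat 1]
      simp only [hr2, hpred]
      rw [show lam1 + kappa * lam1 = (A1 * B1 - A0 * B0) / (B1 * B0 * (A1 - A0)) by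
        rw [eq_div_iff hD']; linear_combination key2]
      exact ((ha1.mul hb1).sub (ha0'.mul hb0')).div ((hb1.mul hb0').mul (ha1.sub ha0')) hD'
    · simp only [hr2, Nat.add_sub_cancel]
      rw [show lam1 + kappa * lam1 = (A0 * B0 - A1 * B1) / (B0 * B1 * (A0 - A1)) by
        rw [eq_div_iff hD]; linear_combination -key2]
      exact ((ha0.mul hb0).sub (ha1.mul hb1)).div ((hb0.mul hb1).mul (ha0.sub ha1)) hD
end

section
/- Let λ > 0 and A = diag(1, λ) a 2×2 real matrix. Let g_{k−2} ∈ ℝ² be nonzero, let α_{k−2}, α_{k−1} ∈ ℝ be nonzero with I − α_{k−2}A and I − α_{k−1}A invertible, let g_{k−1} = (I − α_{k−2}A)g_{k−2} be nonzero, and let g_k = (I − α_{k−1}A)g_{k−1}. Define α_{k−1}^{BB1} = (g_{k−2}ᵀg_{k−2})/(g_{k−2}ᵀAg_{k−2}), α_{k−1}^{BB2} = (g_{k−2}ᵀAg_{k−2})/(g_{k−2}ᵀA²g_{k−2}), α_k^{BB1} = (g_{k−1}ᵀg_{k−1})/(g_{k−1}ᵀAg_{k−1}), α_k^{BB2} =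 (g_{k−1}ᵀAg_{k−1})/(g_{k−1}ᵀA²g_{k−1}), and assume α_{k−1}^{BB1} ≠ α_k^{BB1}. Set r₁ = (α_{k−1}^{BB2} − α_k^{BB2}) / (α_{k−1}^{BB2}·α_k^{BB2}·(α_{k−1}^{BB1} − α_k^{BB1})) and r₂ = (α_{k−1}^{BB1}α_{k−1}^{BB2} − α_k^{BB1}α_k^{BB2}) / (α_{k−1}^{BB2}·α_k^{BB2}·(α_{k−1}^{BB1} − α_k^{BB1})). Then r₁ = λ, r₂ = 1 + λ, and α_k^{new} := 2/(r₂ + √(r₂² − 4r₁)) = min{1, 1/λ}. -/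
open Matrix

/-- The two Barzilai–Borwein stepsizes of a nonzero gradient `g` for the Hessian `diag(1, λ)` satisfy
`λ * BB1 - (1 + λ) + 1 / BB2 = 0`, here in denominator-free form. -/
lemma bb_stepsizes_relation {lam : ℝ} (hlam : 0 < lam) {g : Fin 2 → ℝ} (hg : g ≠ 0) :
    (g ⬝ᵥ (diagonal ![1, lam] *ᵥ g)) / (g ⬝ᵥ (diagonal ![1, lam] ^ 2 *ᵥ g)) *
      (1 + lam - lam * ((g ⬝ᵥ g) / (g ⬝ᵥ (diagonal ![1, lam] *ᵥ g)))) = 1 := by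
  have hpos : 0 < g 0 * g 0 + g 1 * g 1 := by
    by_contra! h
    apply hg
    ext i
    fin_cases i
    · simpa using show g 0 = 0 by nlinarith [mul_self_nonneg (g 0), mul_self_nonneg (g 1)]
    · simpa using show g 1 = 0 by nlinarith [mul_self_nonneg (g 0), mul_self_nonneg (g 1)]
  have pos_of_pos : ∀ c : ℝ, 0 < c → 0 < g 0 * g 0 + g 1 * (c * g 1) := by
    intro c hc
    rcases (mul_self_nonneg (g 1)).eq_or_lt with h | h
    · nlinarith
    · nlinarith [mul_self_nonneg (g 0), mul_pos hc h]
  have hA := (pos_of_pos lam hlam).ne'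
  have hA2 := (pos_of_pos (lam ^ 2) (by positivity)).ne'
  simp only [diagonal_pow, dotProduct, mulVec_diagonal, Fin.sum_univ_two, Pi.pow_apply,
    cons_val_zero, cons_val_one, one_pow, one_mul]
  field_simp at hA hA2 ⊢
  ring

lemma two_div_sum_add_sqrt_discrim {lam : ℝ} (hlam : 0 < lam) :
    2 / (1 + lam + √((1 + lam) ^ 2 - 4 * lam)) = min 1 (1 / lam) := by
  rw [show (1 + lam) ^ 2 - 4 * lam = (1 - lam) ^ 2 by ring, Real.sqrt_sq_eq_abs]
  rcases le_total lam 1 with h | h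
  · rw [abs_of_nonneg (by linarith), min_eq_left ((one_le_div hlam).2 h)]
    norm_num
  · rw [abs_of_nonpos (by linarith), min_eq_right ((div_le_one hlam).2 h)]
    have hsum : 1 + lam + -(1 - lam) = 2 * lam := by ring
    rw [hsum, div_mul_eq_div_div, div_self two_ne_zero]

/-- Two-dimensional quadratic-termination property of the new stepsize: for the
gradient method on a 2D quadratic with Hessian `A = diag(1, λ)`, the coefficient
ratios satisfy `r₁ = λ`, `r₂ = 1 + λ`, and `α_k^{new} = min{1, 1/λ}`. -/
theorem stmt_18 (lam : ℝ) (hlam : 0 < lam)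
    (A : Matrix (Fin 2) (Fin 2) ℝ) (hA : A = Matrix.diagonal ![1, lam])
    (gkm2 : Fin 2 → ℝ) (hgkm2 : gkm2 ≠ 0)
    (αkm2 αkm1 : ℝ) (hαkm2 : αkm2 ≠ 0) (hαkm1 : αkm1 ≠ 0)
    (hinv2 : IsUnit (1 - αkm2 • A)) (hinv1 : IsUnit (1 - αkm1 • A))
    (gkm1 : Fin 2 → ℝ) (hgkm1 : gkm1 = (1 - αkm2 • A) *ᵥ gkm2) (hgkm10 : gkm1 ≠ 0)
    (gk : Fin 2 → ℝ) (hgk : gk = (1 - αkm1 • A) *ᵥ gkm1)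
    (a1 b1 a2 b2 : ℝ)
    (ha1 : a1 = (gkm2 ⬝ᵥ gkm2) / (gkm2 ⬝ᵥ (A *ᵥ gkm2)))
    (hb1 : b1 = (gkm2 ⬝ᵥ (A *ᵥ gkm2)) / (gkm2 ⬝ᵥ (A ^ 2 *ᵥ gkm2)))
    (ha2 : a2 = (gkm1 ⬝ᵥ gkm1) / (gkm1 ⬝ᵥ (A *ᵥ gkm1)))
    (hb2 : b2 = (gkm1 ⬝ᵥ (A *ᵥ gkm1)) / (gkm1 ⬝ᵥ (A ^ 2 *ᵥ gkm1)))
    (hne : a1 ≠ a2)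
    (r1 r2 αnew : ℝ)
    (hr1 : r1 = (b1 - b2) / (b1 * b2 * (a1 - a2)))
    (hr2 : r2 = (a1 * b1 - a2 * b2) / (b1 * b2 * (a1 - a2)))
    (hαnew : αnew = 2 / (r2 + Real.sqrt (r2 ^ 2 - 4 * r1))) :
    r1 = lam ∧ r2 = 1 + lam ∧ αnew = min 1 (1 / lam) := by
  subst hA
  have h1 := bb_stepsizes_relation hlam hgkm2
  have h2 := bb_stepsizes_relation hlam hgkm10
  rw [← ha1, ← hb1] at h1
  rw [← ha2, ← hb2] at h2
  have hb10 : b1 ≠ 0 := left_ne_zero_of_mul_eq_one h1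
  have hb20 : b2 ≠ 0 := left_ne_zero_of_mul_eq_one h2
  have hden : b1 * b2 * (a1 - a2) ≠ 0 :=
    mul_ne_zero (mul_ne_zero hb10 hb20) (sub_ne_zero.2 hne)
  have hr1' : r1 = lam := by
    rw [hr1, div_eq_iff hden]
    linear_combination b2 * h1 - b1 * h2
  have hr2' : r2 = 1 + lam := by
    rw [hr2, div_eq_iff hden]
    linear_combination a2 * b2 * h1 - a1 * b1 * h2
  refine ⟨hr1', hr2', ?_⟩
  rw [hαnew, hr1', hr2', two_div_sum_add_sqrt_discrim hlam]
end
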